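/- arXiv:1206.3065 — 4 statements merged into one kernel-verified Lean document; each statement's English description precedes it below -/
import Mathlib

section
/- Let A ∈ ℝ^{n×n}, B ∈ ℝ^{n×1}, C ∈ ℝ^{1×n} with CB > 0 and set ε = (CB)⁻¹. Suppose there exists a symmetric positive definite matrix Q ∈ ℝ^{n×n} such that (1/2)(AᵀQ + QA) + ε AᵀCᵀCA is negative semidefinite and QB + AᵀCᵀ = 0. Then for all x ∈ ℝⁿ and u ∈ ℝ: (1/2)xᵀ(AᵀQ + QA)x + xᵀQBu ≤ (CAx + CBu)·u − ε·(CAx + CBu)². In other words, along any trajectory of ẋ = Ax + Bu with output y = Cx, the function V(x) = (1/2)xᵀQx satisfies V̇ ≤ ẏ·u − ε·ẏ², so the linear system is strictly counterclockwise (S-CCW). -/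
open Matrix

/-- **S-CCW dissipation inequality for SISO linear systems.**
Let `A ∈ ℝ^{n×n}`, `B ∈ ℝ^{n×1}`, `C ∈ ℝ^{1×n}` with `CB > 0`, `ε = (CB)⁻¹`.
If there is a symmetric positive definite `Q` with
`(1/2)(AᵀQ + QA) + ε AᵀCᵀCA ≤ 0` (negative semidefinite) and `QB + AᵀCᵀ = 0`, then
for all `x ∈ ℝⁿ`, `u ∈ ℝ`:
`(1/2)xᵀ(AᵀQ + QA)x + xᵀQBu ≤ (CAx + CBu)·u − ε·(CAx + CBu)²`,
i.e. `V(x) = (1/2)xᵀQx` satisfies `V̇ ≤ ẏu − εẏ²` along `ẋ = Ax + Bu`, `y = Cx`: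
the linear system is strictly counterclockwise (S-CCW). -/
theorem linear_siso_sccw
    {n : ℕ}
    (A : Matrix (Fin n) (Fin n) ℝ)
    (B : Matrix (Fin n) (Fin 1) ℝ)
    (C : Matrix (Fin 1) (Fin n) ℝ)
    (hCB : 0 < (C * B) 0 0)
    (ε : ℝ) (hε : ε = ((C * B) 0 0)⁻¹)
    (Q : Matrix (Fin n) (Fin n) ℝ)
    (hQ : Q.PosDef)
    (hLMI1 : (-((1/2 : ℝ) • (Aᵀ * Q + Q * A) + ε • (Aᵀ * Cᵀ * C * A))).PosSemidef)
    (hLMI2 : Q * B + Aᵀ * Cᵀ = 0) :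
    ∀ (x : Fin n → ℝ) (u : ℝ),
      (1/2 : ℝ) * (x ⬝ᵥ (Aᵀ * Q + Q * A).mulVec x) + x ⬝ᵥ Q.mulVec (B.mulVec fun _ => u)
        ≤ (((C * A).mulVec x) 0 + (C * B) 0 0 * u) * u
            - ε * (((C * A).mulVec x) 0 + (C * B) 0 0 * u) ^ 2 := by
  intro x u
  have hquad : x ⬝ᵥ (Aᵀ * Cᵀ * C * A) *ᵥ x = ((C * A) *ᵥ x) 0 ^ 2 := by
    rw [← transpose_mul, Matrix.mul_assoc, ← mulVec_mulVec, dotProduct_mulVec, vecMul_transpose]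
    simp [dotProduct, sq]
  have hcross : x ⬝ᵥ Q *ᵥ (B *ᵥ fun _ => u) = -(((C * A) *ᵥ x) 0 * u) := by
    rw [mulVec_mulVec, eq_neg_of_add_eq_zero_left hLMI2, ← transpose_mul, neg_mulVec,
      dotProduct_neg, dotProduct_mulVec, vecMul_transpose]
    simp [dotProduct]
  have hdiss : (1/2 : ℝ) * (x ⬝ᵥ (Aᵀ * Q + Q * A) *ᵥ x) + ε * ((C * A) *ᵥ x) 0 ^ 2 ≤ 0 := by
    have h := hLMI1.dotProduct_mulVec_nonneg x
    rw [star_trivial, neg_mulVec, dotProduct_neg, add_mulVec, dotProduct_add, smul_mulVec,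
      smul_mulVec, dotProduct_smul, dotProduct_smul, hquad, smul_eq_mul, smul_eq_mul] at h
    linarith
  have hεCB : ε * (C * B) 0 0 = 1 := by rw [hε, inv_mul_cancel₀ hCB.ne']
  rw [hcross]
  linear_combination hdiss + (2 * ((C * A) *ᵥ x) 0 * u + (C * B) 0 0 * u ^ 2) * hεCB
end

section
/- Let A ∈ ℝ^{n×n}, B ∈ ℝ^{n×1}, C ∈ ℝ^{1×n}, D ∈ ℝ, let P ∈ ℝ^{(1+n)×(1+n)} be symmetric, let L be a matrix with 1+n columns, and let δ > 0. Suppose P·[1; 0_{n×1}] = [D; Cᵀ] and (1/2)(P·M + Mᵀ·P) + δ LᵀL is negative semidefinite, where M = [0, 0_{1×n}; B, A]. Then for all w ∈ ℝ, x ∈ ℝⁿ and q ∈ ℝ: [w, xᵀ]·P·[q; Ax + Bw] ≤ (Cx + Dw)·q − δ‖L·[w; x]‖². In other words, V(w,x) = (1/2)[w, xᵀ]P[w; x] satisfies V̇ ≤ y·u̇ − δ‖L[u; x]‖² along the extended system ẇ = q, ẋ = Ax + Bw, y = Cx + Dw with w = u, so the linear system is clockwise (CW). -/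
open Matrix

/-- If `½(PM + MᵀP) + δLᵀL` is negative semidefinite with `P` symmetric, then
`zᵀPMz ≤ -δ‖Lz‖²` for every `z`. -/
lemma dotProduct_mulVec_mulVec_le_of_posSemidef_neg {ι κ : Type*} [Fintype ι] [Fintype κ]
    {P M : Matrix ι ι ℝ} (hP : P.IsSymm) {L : Matrix κ ι ℝ} {δ : ℝ}
    (h : (-((1/2 : ℝ) • (P * M + Mᵀ * P) + δ • (Lᵀ * L))).PosSemidef) (z : ι → ℝ) :
    z ⬝ᵥ P *ᵥ (M *ᵥ z) ≤ -(δ * (L *ᵥ z ⬝ᵥ L *ᵥ z)) := by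
  have hz := h.dotProduct_mulVec_nonneg z
  have hM : z ⬝ᵥ Mᵀ *ᵥ (P *ᵥ z) = z ⬝ᵥ P *ᵥ (M *ᵥ z) := by
    rw [dotProduct_mulVec, vecMul_transpose, dotProduct_mulVec, ← mulVec_transpose, hP.eq,
      dotProduct_comm]
  have hL : z ⬝ᵥ Lᵀ *ᵥ (L *ᵥ z) = L *ᵥ z ⬝ᵥ L *ᵥ z := by
    rw [dotProduct_mulVec, vecMul_transpose]
  simp only [star_trivial, neg_mulVec, add_mulVec, smul_mulVec, ← mulVec_mulVec,
    dotProduct_neg, dotProduct_add, dotProduct_smul, hM, hL, smul_eq_mul] at hz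
  linarith

/-- **CW dissipation inequality for SISO linear systems.**
Let `A ∈ ℝ^{n×n}`, `B ∈ ℝ^{n×1}`, `C ∈ ℝ^{1×n}`, `D ∈ ℝ`, let `P` be a symmetric
`(1+n)×(1+n)` matrix, `L` a matrix with `1+n` columns and `δ > 0`.  If
`P·[1; 0] = [D; Cᵀ]` and `(1/2)(P·M + Mᵀ·P) + δLᵀL ≤ 0` (negative semidefinite) for
`M = [0, 0; B, A]`, then for all `w, q ∈ ℝ` and `x ∈ ℝⁿ`:
`[w, xᵀ]·P·[q; Ax + Bw] ≤ (Cx + Dw)·q − δ‖L·[w; x]‖²`,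
i.e. `V(w,x) = (1/2)[w,xᵀ]P[w;x]` satisfies `V̇ ≤ y·u̇ − δ‖L[u;x]‖²` along the extended
system `ẇ = q, ẋ = Ax + Bw, y = Cx + Dw` with `w = u`: the linear system is CW. -/
theorem linear_siso_cw
    {n k : ℕ}
    (A : Matrix (Fin n) (Fin n) ℝ)
    (B : Matrix (Fin n) (Fin 1) ℝ)
    (C : Matrix (Fin 1) (Fin n) ℝ)
    (D : ℝ)
    (P : Matrix (Fin 1 ⊕ Fin n) (Fin 1 ⊕ Fin n) ℝ)
    (hP : P.IsSymm)
    (L : Matrix (Fin k) (Fin 1 ⊕ Fin n) ℝ)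
    (δ : ℝ) (hδ : 0 < δ)
    (hP1 : P.mulVec (Sum.elim (fun _ => (1:ℝ)) (fun _ => 0)) =
      Sum.elim (fun _ => D) (fun i => C 0 i))
    (hLMI : (-((1/2 : ℝ) • (P * Matrix.fromBlocks 0 0 B A +
        (Matrix.fromBlocks 0 0 B A)ᵀ * P) + δ • (Lᵀ * L))).PosSemidef) :
    ∀ (w : ℝ) (x : Fin n → ℝ) (q : ℝ),
      (Sum.elim (fun _ : Fin 1 => w) x) ⬝ᵥ
          P.mulVec (Sum.elim (fun _ : Fin 1 => q) (A.mulVec x + B.mulVec fun _ => w))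
        ≤ ((C.mulVec x) 0 + D * w) * q
            - δ * (L.mulVec (Sum.elim (fun _ : Fin 1 => w) x) ⬝ᵥ
                   L.mulVec (Sum.elim (fun _ : Fin 1 => w) x)) := by
  intro w x q
  set z : Fin 1 ⊕ Fin n → ℝ := Sum.elim (fun _ => w) x with hz
  have hsplit : (Sum.elim (fun _ : Fin 1 => q) (A *ᵥ x + B *ᵥ fun _ => w)) =
      q • Sum.elim (fun _ : Fin 1 => (1 : ℝ)) (fun _ : Fin n => 0) +
        fromBlocks 0 0 B A *ᵥ z := by
    rw [hz, fromBlocks_mulVec]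
    ext (i | i) <;> simp [Function.comp_def, add_comm]
  have hout : z ⬝ᵥ Sum.elim (fun _ : Fin 1 => D) (fun i => C 0 i) =
      (C *ᵥ x) 0 + D * w := by
    simp [hz, dotProduct, mulVec, mul_comm, add_comm]
  have hle := dotProduct_mulVec_mulVec_le_of_posSemidef_neg hP hLMI z
  rw [hsplit, mulVec_add, mulVec_smul, hP1, dotProduct_add, dotProduct_smul, hout, smul_eq_mul]
  linarith
end

section
/- Let f_an : ℝ → ℝ be a continuous, strictly increasing bijection. Let γ, v ∈ ℝ with γ ≥ f_an(v), and set c = (γ − f_an(v))/2 + f_an(v) = (γ + f_an(v))/2. Then ∫_v^{f_an⁻¹(γ)} (γ − f_an(σ)) dσ ≥ (1/2)·(γ − f_an(v))·(f_an⁻¹(c) − v) ≥ 0. In particular, the function V(γ,v) = ∫_v^{f_an⁻¹(γ)} (γ − f_an(σ)) dσ is nonnegative, vanishes only when γ = f_an(v), and for fixed v tends to ∞ as γ → ∞. -/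
/-- For a continuous monotone `f` and `v ≤ w ≤ u`, the area between `f` and the level `f u` over
`[v, u]` contains a rectangle with base `[v, w]` and height `f u - f w`. -/
theorem Monotone.sub_mul_sub_le_integral {f : ℝ → ℝ} (hf : Continuous f) (hm : Monotone f)
    {v w u : ℝ} (hvw : v ≤ w) (hwu : w ≤ u) :
    (f u - f w) * (w - v) ≤ ∫ σ in v..u, (f u - f σ) := by
  have hint : ∀ a b : ℝ, IntervalIntegrable (fun σ => f u - f σ) MeasureTheory.volume a b :=
    fun a b => (continuous_const.sub hf).intervalIntegrable a b
  rw [← intervalIntegral.integral_add_adjacent_intervals (hint v w) (hint w u)]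
  have hleft : ∫ _ in v..w, (f u - f w) ≤ ∫ σ in v..w, (f u - f σ) :=
    intervalIntegral.integral_mono_on hvw intervalIntegrable_const (hint v w)
      fun σ hσ => sub_le_sub_left (hm hσ.2) _
  have hright : 0 ≤ ∫ σ in w..u, (f u - f σ) :=
    intervalIntegral.integral_nonneg hwu fun σ hσ => sub_nonneg.2 (hm hσ.2)
  rw [intervalIntegral.integral_const, smul_eq_mul] at hleft
  linarith

/-- **Key lower-bound estimate for the CCW–CCW Lyapunov function.**
Let `f_an : ℝ → ℝ` be a continuous strictly increasing bijection, `γ ≥ f_an(v)`,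
and `c = (γ + f_an(v))/2`.  Then
`∫_v^{f_an⁻¹(γ)} (γ − f_an(σ)) dσ ≥ (1/2)(γ − f_an(v))(f_an⁻¹(c) − v) ≥ 0`.
Moreover `V(γ,v) = ∫_v^{f_an⁻¹(γ)} (γ − f_an(σ)) dσ` vanishes only when
`γ = f_an(v)`, and for fixed `v` it tends to `∞` as `γ → ∞`. -/
theorem ccw_lyapunov_lower_bound
    (fan : ℝ → ℝ) (hcont : Continuous fan) (hmono : StrictMono fan)
    (hbij : Function.Bijective fan)
    (v γ : ℝ) (hγ : fan v ≤ γ) :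
    (0 ≤ (1/2 : ℝ) * (γ - fan v) * (Function.invFun fan ((γ + fan v) / 2) - v)) ∧
    ((1/2 : ℝ) * (γ - fan v) * (Function.invFun fan ((γ + fan v) / 2) - v) ≤
      ∫ σ in v..(Function.invFun fan γ), (γ - fan σ)) ∧
    (0 ≤ ∫ σ in v..(Function.invFun fan γ), (γ - fan σ)) ∧
    ((∫ σ in v..(Function.invFun fan γ), (γ - fan σ)) = 0 → γ = fan v) ∧
    Filter.Tendsto (fun γ' : ℝ => ∫ σ in v..(Function.invFun fan γ'), (γ' - fan σ))
      Filter.atTop Filter.atTop := by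
  have hinv : ∀ y, fan (Function.invFun fan y) = y := Function.rightInverse_invFun hbij.2
  have hle : ∀ {x y}, fan x ≤ y → x ≤ Function.invFun fan y := fun {x y} h =>
    hmono.le_iff_le.1 (by rwa [hinv])
  have hbound : ∀ {w y}, v ≤ w → fan w ≤ y →
      (y - fan w) * (w - v) ≤ ∫ σ in v..(Function.invFun fan y), (y - fan σ) := by
    intro w y hvw hwy
    simpa only [hinv] using hmono.monotone.sub_mul_sub_le_integral hcont hvw (hle hwy)
  have hvc : v ≤ Function.invFun fan ((γ + fan v) / 2) := hle (by linarith)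
  have hnonneg : 0 ≤ (1/2 : ℝ) * (γ - fan v) * (Function.invFun fan ((γ + fan v) / 2) - v) :=
    mul_nonneg (by linarith) (sub_nonneg.2 hvc)
  have hlower : (1/2 : ℝ) * (γ - fan v) * (Function.invFun fan ((γ + fan v) / 2) - v) ≤
      ∫ σ in v..(Function.invFun fan γ), (γ - fan σ) := by
    have h := hbound (y := γ) hvc (by rw [hinv]; linarith)
    rw [hinv] at h
    convert h using 2
    ring
  refine ⟨hnonneg, hlower, hnonneg.trans hlower, fun hzero => ?_, ?_⟩
  · by_contra hne
    have hlt : fan v < γ := lt_of_le_of_ne hγ (Ne.symm hne)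
    have hvc' : v < Function.invFun fan ((γ + fan v) / 2) :=
      hmono.lt_iff_lt.1 (by rw [hinv]; linarith)
    have hpos : 0 < (1/2 : ℝ) * (γ - fan v) * (Function.invFun fan ((γ + fan v) / 2) - v) :=
      mul_pos (by linarith) (sub_pos.2 hvc')
    linarith
  · refine Filter.tendsto_atTop_mono' _ ?_
      (Filter.tendsto_atTop_add_const_right Filter.atTop (-fan (v + 1)) Filter.tendsto_id)
    filter_upwards [Filter.eventually_ge_atTop (fan (v + 1))] with y hy
    have h := hbound (w := v + 1) (by linarith) hy
    rw [id]
    linarith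
end

section
/- Let C_α > 0 and b > a > 0, and define f₁(γ,v) = C_α(bv − γ) + a. Fix (γ,v) ∈ ℝ² with γ ≥ bv, and let z(σ) = bσ + (a − b)/C_α + (γ − bv + (b − a)/C_α)·e^{−C_α(σ − v)} be the increasing-branch traversing function of the Coleman–Hodgdon model through (γ,v). Define σ* = v − (1/C_α)·ln[ ((b − a)/C_α) / (γ − bv + (b − a)/C_α) ]. Then the logarithm is well defined (its argument lies in (0,1]), σ* ≥ v, and z(σ*) = b·σ* = f_an(σ*); that is, σ* is the CCW intersection point of the traversing curve with the anhysteresis line f_an(v) = bv. -/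
/-- **CCW intersection point for the Coleman–Hodgdon model.**
Let `C_α > 0`, `b > a > 0`, and let `γ ≥ bv`.  With the increasing-branch traversing
function `z(σ) = bσ + (a − b)/C_α + (γ − bv + (b − a)/C_α)·exp(−C_α(σ − v))` through
`(γ,v)`, the point `σ* = v − (1/C_α)·ln[((b − a)/C_α)/(γ − bv + (b − a)/C_α)]`
is well defined (the argument of the logarithm lies in `(0,1]`), satisfies `σ* ≥ v`,
and `z(σ*) = b·σ* = f_an(σ*)`: it is the CCW intersection point of the traversing
curve with the anhysteresis line `f_an(v) = bv`. -/
theorem coleman_hodgdon_ccw_intersection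
    (Cα b a : ℝ) (hCα : 0 < Cα) (hba : a < b) (ha : 0 < a)
    (γ v : ℝ) (hγ : b * v ≤ γ)
    (z : ℝ → ℝ)
    (hz : ∀ σ : ℝ, z σ =
      b * σ + (a - b) / Cα + (γ - b * v + (b - a) / Cα) * Real.exp (-Cα * (σ - v)))
    (σstar : ℝ)
    (hσstar : σstar =
      v - (1 / Cα) * Real.log (((b - a) / Cα) / (γ - b * v + (b - a) / Cα))) :
    (0 < ((b - a) / Cα) / (γ - b * v + (b - a) / Cα)) ∧
    (((b - a) / Cα) / (γ - b * v + (b - a) / Cα) ≤ 1) ∧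
    (v ≤ σstar) ∧
    (z σstar = b * σstar) := by
  have hd : 0 < (b - a) / Cα := div_pos (sub_pos.2 hba) hCα
  have hK : 0 < γ - b * v + (b - a) / Cα := by linarith
  have hpos := div_pos hd hK
  have hle : ((b - a) / Cα) / (γ - b * v + (b - a) / Cα) ≤ 1 :=
    (div_le_one hK).2 (by linarith)
  refine ⟨hpos, hle, ?_, ?_⟩
  · have hlog := mul_nonpos_of_nonneg_of_nonpos (one_div_pos.2 hCα).le
      (Real.log_nonpos hpos.le hle)
    linarith
  · have hexponent : -Cα * (σstar - v) =
        Real.log (((b - a) / Cα) / (γ - b * v + (b - a) / Cα)) := by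
      rw [hσstar, sub_sub_cancel_left, neg_mul_neg, ← mul_assoc,
        mul_one_div_cancel hCα.ne', one_mul]
    rw [hz, hexponent, Real.exp_log hpos, mul_div_cancel₀ _ hK.ne']
    ring
end
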